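/- Fix an integer k ≥ 1. Then, as q → 1⁻ (with q ∈ (0,1)), the difference Ẽ_{2k}(q) − (−1)^k·(2π)^(2k)/(log q)^(2k) tends to 0. -/

import Mathlib

open Filter Topology Finset Real

/-- The Eisenstein series `E_{2k}(q) = 1 + (2/ζ(1-2k)) ∑_{n≥1} σ_{2k-1}(n) qⁿ`. -/
noncomputable def eisenstein (k : ℕ) (q : ℝ) : ℂ :=
  1 + 2 / riemannZeta (1 - 2 * (k : ℂ)) *
    (((∑' n : ℕ, (∑ d ∈ Nat.divisors (n + 1), (d : ℝ) ^ (2 * k - 1)) * q ^ (n + 1)) : ℝ) : ℂ)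

/-- The modified Eisenstein series `Ẽ_{2k}(q) = E_{2k}(q) + 2ζ(2-2k)/(ζ(1-2k)·log q)`. -/
noncomputable def eisensteinMod (k : ℕ) (q : ℝ) : ℂ :=
  eisenstein k q +
    2 * riemannZeta (2 - 2 * (k : ℂ)) / (riemannZeta (1 - 2 * (k : ℂ)) * (Real.log q : ℂ))

noncomputable def sigSer (k : ℕ) (q : ℝ) : ℝ :=
  ∑' n : ℕ, (∑ d ∈ Nat.divisors (n + 1), (d : ℝ) ^ (2 * k - 1)) * q ^ (n + 1)

lemma eisenstein_eq (k : ℕ) (hk : 1 ≤ k) (q : ℝ) :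
    eisenstein k q = 1 - (2 * (2 * k : ℕ) / (bernoulli (2 * k) : ℂ)) * (sigSer k q : ℂ) := by
  unfold eisenstein sigSer
  have h : riemannZeta (1 - 2 * (k : ℂ)) = - bernoulli (2 * k) / (2 * k : ℕ) := by
    obtain ⟨m, rfl⟩ := Nat.exists_eq_add_of_le' hk
    have := riemannZeta_neg_nat_eq_bernoulli (2 * m + 1)
    rw [show (1 - 2 * ((m + 1 : ℕ) : ℂ)) = -((2 * m + 1 : ℕ) : ℂ) by push_cast; ring, this]
    rw [show 2 * m + 1 + 1 = 2 * (m + 1) by ring, pow_succ, pow_mul]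
    push_cast
    norm_num
    ring
  rw [h]
  generalize ((_ : ℝ) : ℂ) = x
  rw [neg_div, div_neg, div_div_eq_mul_div]
  ring

noncomputable def zpt (y : ℝ) (hy : 0 < y) : UpperHalfPlane := ⟨Complex.I * y, by simpa using hy⟩

lemma exp_zpt (y : ℝ) (hy : 0 < y) :
    Complex.exp (2 * π * Complex.I * (zpt y hy : ℂ)) = ((Real.exp (-2 * π * y) : ℝ) : ℂ) := by
  have : ((zpt y hy : UpperHalfPlane) : ℂ) = Complex.I * y := rfl
  rw [this]
  push_cast
  congr 1
  linear_combination (2 * π * y : ℂ) * Complex.I_sq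

lemma sigSer_eq (k : ℕ) (y : ℝ) (hy : 0 < y) :
    (sigSer k (Real.exp (-2 * π * y)) : ℂ) =
    ∑' n : ℕ+, (ArithmeticFunction.sigma (2 * k - 1) n : ℂ) *
      Complex.exp (2 * π * Complex.I * (zpt y hy : ℂ)) ^ (n : ℕ) := by
  rw [exp_zpt]
  rw [tsum_pnat_eq_tsum_succ (f := fun n : ℕ => (ArithmeticFunction.sigma (2 * k - 1) n : ℂ) *
    ((Real.exp (-2 * π * y) : ℝ) : ℂ) ^ n)]
  unfold sigSer
  rw [Complex.ofReal_tsum]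
  refine tsum_congr fun n => ?_
  rw [ArithmeticFunction.sigma_apply]
  push_cast
  rfl

lemma coe_S_smul (y : ℝ) (hy : 0 < y) :
    ModularGroup.S • zpt y hy = zpt (1 / y) (by positivity) := by
  rw [UpperHalfPlane.modular_S_smul]
  ext
  change (-(Complex.I * y))⁻¹ = Complex.I * ((1 / y : ℝ) : ℂ)
  have : (y : ℂ) ≠ 0 := by exact_mod_cast hy.ne'
  push_cast
  field_simp
  simp

lemma eisenstein_transform_ge (k : ℕ) (hk : 2 ≤ k) (y : ℝ) (hy : 0 < y) :
    eisenstein k (Real.exp (-2 * π * (1 / y))) =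
      (Complex.I * y) ^ (2 * k) * eisenstein k (Real.exp (-2 * π * y)) := by
  have key : ∀ (y : ℝ) (hy : 0 < y), eisenstein k (Real.exp (-2 * π * y)) =
      ModularForm.E (k := 2 * k) (by omega) (zpt y hy) := by
    intro y hy
    rw [eisenstein_eq k (by omega), EisensteinSeries.q_expansion_bernoulli _ (by simp), sigSer_eq k y hy]
    simp
  rw [key y hy, key (1 / y) (by positivity), ← coe_S_smul]
  have := SlashInvariantForm.slash_action_eqn'' (ModularForm.E (k := 2 * k) (by omega))
    (γ := Matrix.SpecialLinearGroup.mapGL ℝ ModularGroup.S)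
    (MonoidHom.mem_range.mpr ⟨ModularGroup.S, rfl⟩) (zpt y hy)
  refine this.trans ?_
  congr 1
  have hd : UpperHalfPlane.denom (Matrix.SpecialLinearGroup.mapGL ℝ ModularGroup.S) (zpt y hy)
      = Complex.I * y := by
    have hz : ((zpt y hy : UpperHalfPlane) : ℂ) = Complex.I * y := rfl
    rw [← hz]
    exact ModularGroup.denom_S (zpt y hy)
  rw [hd]
  exact_mod_cast rfl

lemma eisenstein_transform_one (y : ℝ) (hy : 0 < y) :
    eisenstein 1 (Real.exp (-2 * π * (1 / y))) =
      (Complex.I * y) ^ 2 * (eisenstein 1 (Real.exp (-2 * π * y)) - 6 / (π * y)) := by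
  have key : ∀ (y : ℝ) (hy : 0 < y), eisenstein 1 (Real.exp (-2 * π * y)) =
      (1 / (2 * riemannZeta 2)) * EisensteinSeries.G2 (zpt y hy) := by
    intro y hy
    have h2 : EisensteinSeries.E2 (zpt y hy) =
      (1 / (2 * riemannZeta 2)) * EisensteinSeries.G2 (zpt y hy) := rfl
    rw [← h2, eisenstein_eq 1 (by omega), EisensteinSeries.E2_eq_tsum_cexp, sigSer_eq 1 y hy]
    norm_num [bernoulli_two, bernoulli]
  rw [key y hy, key (1 / y) (by positivity), ← coe_S_smul y hy, EisensteinSeries.G2_S_transform (zpt y hy)]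
  have hz : ((zpt y hy : UpperHalfPlane) : ℂ) = Complex.I * y := rfl
  rw [hz, riemannZeta_two]
  have : (y : ℂ) ≠ 0 := by exact_mod_cast hy.ne'
  have : (π : ℂ) ≠ 0 := by exact_mod_cast Real.pi_ne_zero
  field_simp
  ring_nf

lemma eisensteinMod_exp (k : ℕ) (hk : 1 ≤ k) (y : ℝ) (hy : 0 < y) :
    eisenstein k (Real.exp (-2 * π * (1 / y))) =
      (Complex.I * y) ^ (2 * k) * eisensteinMod k (Real.exp (-2 * π * y)) := by
  have hy' : (y : ℂ) ≠ 0 := by exact_mod_cast hy.ne'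
  have hp : (π : ℂ) ≠ 0 := by exact_mod_cast Real.pi_ne_zero
  unfold eisensteinMod
  rcases hk.eq_or_lt with rfl | hk
  · rw [eisenstein_transform_one y hy, mul_one, Real.log_exp]
    have h1 : riemannZeta (1 - 2 * ((1 : ℕ) : ℂ)) = -1 / 12 := by
      have := riemannZeta_neg_nat_eq_bernoulli 1
      rw [show (1 - 2 * ((1 : ℕ) : ℂ)) = -((1 : ℕ) : ℂ) by norm_num, this]
      norm_num [bernoulli_two, bernoulli]
    rw [h1, show (2 - 2 * ((1 : ℕ) : ℂ)) = 0 by norm_num, riemannZeta_zero]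
    push_cast
    field_simp
    ring
  · rw [eisenstein_transform_ge k hk y hy]
    obtain ⟨m, rfl⟩ := Nat.exists_eq_add_of_le' hk
    have := riemannZeta_neg_two_mul_nat_add_one m
    rw [show (2 - 2 * ((m + Nat.succ 1 : ℕ) : ℂ)) = -2 * (m + 1) by push_cast; ring, this]
    simp

lemma sigSer_bound (k : ℕ) : ∃ C : ℝ, ∀ q : ℝ, 0 ≤ q → q ≤ 1 / 2 → |sigSer k q| ≤ C * q := by
  have hs : Summable fun n : ℕ =>
      (∑ d ∈ Nat.divisors (n + 1), (d : ℝ) ^ (2 * k - 1)) * (1 / 2 : ℝ) ^ n := by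
    have h0 : Summable fun n : ℕ => (ArithmeticFunction.sigma (2 * k - 1) (n : ℕ) : ℝ) *
        (1 / 2 : ℝ) ^ n := by
      refine Summable.of_nonneg_of_le (fun n => by positivity) (fun n => ?_)
        (summable_pow_mul_geometric_of_norm_lt_one (2 * k - 1 + 1) (r := (1 / 2 : ℝ)) (by norm_num))
      gcongr
      exact_mod_cast ArithmeticFunction.sigma_le_pow_succ (2 * k - 1) n
    refine (((summable_nat_add_iff 1).mpr h0).mul_left 2).congr fun n => ?_
    rw [ArithmeticFunction.sigma_apply, pow_succ]
    push_cast
    ring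
  refine ⟨∑' n : ℕ, (∑ d ∈ Nat.divisors (n + 1), (d : ℝ) ^ (2 * k - 1)) * (1 / 2 : ℝ) ^ n, ?_⟩
  intro q h0 h1
  unfold sigSer
  rw [← tsum_mul_right]
  refine (tsum_of_norm_bounded (f := fun n : ℕ =>
    (∑ d ∈ Nat.divisors (n + 1), (d : ℝ) ^ (2 * k - 1)) * q ^ (n + 1)) (hs.mul_right q).hasSum ?_)
  intro n
  rw [Real.norm_of_nonneg (by positivity), pow_succ, ← mul_assoc]
  gcongr

/-- For `k ≥ 1`, `Ẽ_{2k}(q) − (−1)^k (2π)^{2k}/(log q)^{2k} → 0`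
as `q → 1⁻`; that is, `Ẽ_{2k}(q) ≃ (2πi/log q)^{2k}`. -/
theorem eisensteinMod_asymptotic (k : ℕ) (hk : 1 ≤ k) :
    Tendsto (fun q : ℝ =>
        eisensteinMod k q - (-1) ^ k * (2 * (Real.pi : ℂ)) ^ (2 * k) /
          ((Real.log q : ℂ)) ^ (2 * k))
      (𝓝[Set.Ioo (0 : ℝ) 1] 1) (𝓝 0) := by
  obtain ⟨C, hC⟩ := sigSer_bound k
  -- the variable x = 1 / y, where q = exp (-2 π y)
  let x : ℝ → ℝ := fun q => 2 * π / (-Real.log q)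
  have hx : Tendsto x (𝓝[Set.Ioo (0 : ℝ) 1] 1) atTop := by
    have h1 : Tendsto (fun q : ℝ => -Real.log q) (𝓝[Set.Ioo (0 : ℝ) 1] 1) (𝓝[>] 0) := by
      refine tendsto_nhdsWithin_iff.mpr ⟨?_, ?_⟩
      · have : ContinuousAt (fun q : ℝ => -Real.log q) 1 :=
          (Real.continuousAt_log one_ne_zero).neg
        have h2 := this.tendsto
        simp only [Real.log_one, neg_zero] at h2
        exact h2.mono_left nhdsWithin_le_nhds
      · filter_upwards [self_mem_nhdsWithin] with q hq
        have := Real.log_neg hq.1 hq.2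
        simpa using this
    simpa [x, div_eq_mul_inv] using
      (tendsto_inv_nhdsGT_zero.comp h1).const_mul_atTop (by positivity : 0 < 2 * π)
  have hdec : Tendsto (fun x : ℝ => x ^ (2 * k) * Real.exp (-(2 * π) * x)) atTop (𝓝 0) := by
    have := tendsto_rpow_mul_exp_neg_mul_atTop_nhds_zero ((2 * k : ℕ) : ℝ) (2 * π) (by positivity)
    simpa only [Real.rpow_natCast] using this
  have hsmall : ∀ᶠ x : ℝ in atTop, Real.exp (-(2 * π) * x) ≤ 1 / 2 := by
    have : Tendsto (fun x : ℝ => Real.exp (-(2 * π) * x)) atTop (𝓝 0) := by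
      refine Real.tendsto_exp_atBot.comp ?_
      exact tendsto_id.const_mul_atTop_of_neg (by linarith [Real.pi_pos])
    exact this.eventually_le_const (by norm_num)
  set c : ℂ := 2 * (2 * k : ℕ) / (bernoulli (2 * k) : ℂ) with hc
  have hlim : Tendsto (fun q => ‖c‖ * C * ((x q) ^ (2 * k) * Real.exp (-(2 * π) * x q)))
      (𝓝[Set.Ioo (0 : ℝ) 1] 1) (𝓝 0) := by
    simpa using (hdec.comp hx).const_mul (‖c‖ * C)
  refine squeeze_zero_norm' ?_ hlim
  filter_upwards [self_mem_nhdsWithin, hx.eventually hsmall] with q hq hsm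
  have hl := Real.log_neg hq.1 hq.2
  have hpi := Real.pi_pos
  have hy : 0 < -Real.log q / (2 * π) := by
    apply div_pos <;> linarith
  have hT := eisensteinMod_exp k hk _ hy
  rw [show -2 * π * (-Real.log q / (2 * π)) = Real.log q by field_simp, Real.exp_log hq.1,
    show -2 * π * (1 / (-Real.log q / (2 * π))) = -(2 * π) * x q by
      simp only [x]; rw [one_div_div]; ring, eisenstein_eq k hk, ← hc] at hT
  have hlc : (Real.log q : ℂ) ≠ 0 := by exact_mod_cast hl.ne
  have hpc : (π : ℂ) ≠ 0 := by exact_mod_cast hpi.ne'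
  have hpow : (Complex.I * ((-Real.log q / (2 * π) : ℝ) : ℂ)) ^ (2 * k) *
      ((-1) ^ k * (x q : ℂ) ^ (2 * k)) = 1 := by
    simp only [x]
    push_cast
    rw [pow_mul, pow_mul _ 2 k, ← mul_pow, ← mul_pow]
    convert one_pow k using 2
    rw [mul_pow, Complex.I_sq]
    field_simp
  have hpow2 : (-1 : ℂ) ^ k * (2 * (π : ℂ)) ^ (2 * k) / (Real.log q : ℂ) ^ (2 * k) =
      (-1) ^ k * (x q : ℂ) ^ (2 * k) := by
    simp only [x]
    push_cast
    rw [div_pow, Even.neg_pow (by simp : Even (2 * k)) (Real.log q : ℂ), mul_div_assoc]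
  have hfin : eisensteinMod k q - (-1) ^ k * (2 * (π : ℂ)) ^ (2 * k) / (Real.log q : ℂ) ^ (2 * k) =
      -((-1) ^ k * (x q : ℂ) ^ (2 * k) * (c * sigSer k (Real.exp (-(2 * π) * x q)))) := by
    rw [hpow2]
    linear_combination (-((-1) ^ k * (x q : ℂ) ^ (2 * k))) * hT - eisensteinMod k q * hpow
  have hxpos : 0 ≤ x q := by
    simp only [x]; apply div_nonneg <;> linarith
  rw [hfin]
  simp only [norm_neg, norm_mul, norm_pow, norm_one, one_pow, one_mul, Complex.norm_real,
    Real.norm_eq_abs, abs_of_nonneg hxpos]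
  have := hC _ (Real.exp_pos (-(2 * π) * x q)).le hsm
  calc x q ^ (2 * k) * (‖c‖ * |sigSer k (Real.exp (-(2 * π) * x q))|)
      ≤ x q ^ (2 * k) * (‖c‖ * (C * Real.exp (-(2 * π) * x q))) := by gcongr
    _ = _ := by ring
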